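/- arXiv:2309.14644 — 5 statements merged into one kernel-verified Lean document; each statement's English description precedes it below -/
import Mathlib

section
/- Let P(x) = Σ_{n≥1} s(n)·x^n ∈ ℤ⟦x⟧ be the formal power series whose n-th coefficient is the number s(n) of standardized sock sequences of length n that are 1-stack-sortable under φ_{aba}. Then P satisfies the identity 2x(1−x)·P(x)² − (1−3x+3x²)·P(x) + x(1−x) = 0 in the ring of formal power series. (This polynomial identity is equivalent to the closed form P(x) = [(−1+3x−3x²) + √(1−6x+7x²−2x³+x⁴)]/(4(x²−x)).) -/
attribute [local instance] Classical.propDecidable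

/-- Two lists have the same shape: same length and identical equality pattern
of entries (`q_i = q_j` iff `r_i = r_j`). -/
def SameShape {A : Type*} {B : Type*} (q : List A) (r : List B) : Prop :=
  q.length = r.length ∧ ∀ i j : ℕ, (q[i]? = q[j]? ↔ r[i]? = r[j]?)

/-- `ContainsPat p σ` : the sock sequence `p` contains the pattern `σ`
(not necessarily consecutively): there are indices `i_1 < ⋯ < i_m` such that
`p_{i_j} = p_{i_k} ↔ σ_j = σ_k`. -/
def ContainsPat {A : Type*} {B : Type*} (p : List A) (σ : List B) : Prop :=
  ∃ q : List A, q.Sublist p ∧ SameShape q σ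

/-- A sock sequence is sorted if all occurrences of each sock appear
consecutively. -/
def SortedSocks {A : Type*} (p : List A) : Prop :=
  ∀ i j k : ℕ, i ≤ j → j ≤ k → p[i]? = p[k]? → p[j]? = p[i]?

/-- One pass of the deterministic σ-avoiding stack-sorting procedure:
`sortAux σ input stack` runs the σ-avoiding stack with the given remaining
input and current stack (stack listed from top to bottom), returning the rest
of the output.  If input remains and pushing the next input sock onto the
stack does not create a σ-pattern in the stack, that sock is pushed; otherwise
the top sock of the stack is popped to the output. -/
noncomputable def sortAux {A : Type*} {B : Type*} (σ : List B) : List A → List A → List A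
  | [], stack => stack
  | x :: input, stack =>
    if ContainsPat (x :: stack) σ then
      match stack with
      | [] => sortAux σ input [x]
      | t :: rest => t :: sortAux σ (x :: input) rest
    else
      sortAux σ input (x :: stack)
termination_by input stack => 2 * input.length + stack.length
decreasing_by all_goals simp only [List.length_cons]; omega

/-- The deterministic σ-avoiding stack-sorting map `φ_σ`. -/
noncomputable def phi {A : Type*} {B : Type*} (σ : List B) (p : List A) : List A :=
  sortAux σ p []

/-- The pattern `aba`: first and third socks equal, distinct from the second. -/
def abaPat : List ℕ := [0, 1, 0]

/-- A sock sequence over `ℕ` is standardized if its first entry is `0` and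
each subsequent entry is at most one more than the maximum of all preceding
entries. -/
def Standardized (p : List ℕ) : Prop :=
  ∀ i : Fin p.length, p.get i ≤ (p.take i).foldr (fun a b => max (a + 1) b) 0

/-- `sCount n` is the number of standardized sock sequences of length `n`
that are `1`-stack-sortable under `φ_{aba}`. -/
noncomputable def sCount (n : ℕ) : ℕ :=
  Set.ncard {p : List ℕ | p.length = n ∧ Standardized p ∧
    SortedSocks (phi abaPat p)}

/-- A recursive form of `SortedSocks`: an entry that occurs again occurs immediately afterwards. -/
def Grouped : List ℕ → Prop
  | [] => True
  | a :: l => (a ∈ l → l.head? = some a) ∧ Grouped l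

theorem sortedSocks_iff_grouped (l : List ℕ) : SortedSocks l ↔ Grouped l := by
  constructor
  · intro h
    induction l with
    | nil => trivial
    | cons a l ih =>
      refine ⟨fun ha => ?_, ih fun i j k hij hjk hik => ?_⟩
      · obtain ⟨k, hk⟩ := List.mem_iff_getElem?.1 ha
        have := h 0 1 (k + 1) (by omega) (by omega) (by simp [hk])
        simpa [List.head?_eq_getElem?] using this
      · simpa using h (i + 1) (j + 1) (k + 1) (by omega) (by omega) (by simpa using hik)
  · intro h
    induction l with
    | nil => intro i j k _ _ _; simp
    | cons a l ih =>
      obtain ⟨ha, hl⟩ := h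
      have ih := ih hl
      intro i j k hij hjk hik
      rcases i with _ | i
      · rcases j with _ | j
        · rfl
        rcases k with _ | k
        · omega
        have hk : l[k]? = some a := by simpa using hik.symm
        have h0 : l[0]? = some a := by
          rw [← List.head?_eq_getElem?]; exact ha (List.mem_of_getElem? hk)
        have := ih 0 j k (by omega) (by omega) (by rw [h0, hk])
        simpa [h0] using this
      · rcases j with _ | j
        · omega
        rcases k with _ | k
        · omega
        simpa using ih i j k (by omega) (by omega) (by simpa using hik)

theorem Grouped.sublist {l l' : List ℕ} (h : l.Sublist l') (hl : Grouped l') : Grouped l := by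
  induction h with
  | slnil => trivial
  | cons a _ ih => exact ih hl.2
  | @cons_cons l₁ l₂ a hs ih =>
    refine ⟨fun ha => ?_, ih hl.2⟩
    have h2 := hl.1 (hs.subset ha)
    rcases l₂ with _ | ⟨b, t⟩
    · simp at h2
    obtain rfl : b = a := by simpa using h2
    rcases l₁ with _ | ⟨c, t'⟩
    · simp at ha
    by_cases hc : c = b
    · simp [hc]
    exfalso
    have hct : (c :: t').Sublist t := by
      cases hs with
      | cons _ h => exact h
      | cons_cons => exact absurd rfl hc
    have hbt : b ∈ t := hct.subset ha
    have hg := hl.2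
    have : ∀ t : List ℕ, Grouped (b :: t) → ∀ u : List ℕ, u.Sublist t → b ∈ u → u.head? = some b := by
      intro t
      induction t with
      | nil => intro _ u hu hb; rw [List.sublist_nil.1 hu] at hb; simp at hb
      | cons d t iht =>
        intro hd u hu hb
        obtain rfl : d = b := by simpa using hd.1 (hu.subset hb)
        cases hu with
        | cons _ h => exact iht hd.2 u h hb
        | cons_cons => simp
    exact hc (by simpa using this t hg _ hct ha)

theorem containsPat_aba_iff (l : List ℕ) : ContainsPat l abaPat ↔ ¬ Grouped l := by
  constructor
  · rintro ⟨q, hq, hlen, hs⟩ hl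
    have hg := hl.sublist hq
    rcases q with _ | ⟨a, _ | ⟨b, _ | ⟨c, _ | ⟨d, q⟩⟩⟩⟩ <;> simp [abaPat] at hlen
    have h02 := hs 0 2
    have h01 := hs 0 1
    simp [abaPat] at h02 h01
    subst h02
    have := hg.1 (by simp)
    simp at this
    exact h01 this.symm
  · intro h
    induction l with
    | nil => exact absurd trivial h
    | cons a l ih =>
      by_cases hl : Grouped l
      · have h1 : ¬ (a ∈ l → l.head? = some a) := fun h1 => h ⟨h1, hl⟩
        push Not at h1
        obtain ⟨ha, hh⟩ := h1
        rcases l with _ | ⟨b, t⟩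
        · simp at ha
        have hb : b ≠ a := by simpa using hh
        have hat : a ∈ t := by simpa [hb.symm] using ha
        refine ⟨[a, b, a], by simpa using hat, rfl, ?_⟩
        intro i j
        rcases i with _ | _ | _ | i <;> rcases j with _ | _ | _ | j <;>
          simp [abaPat, hb, hb.symm]
      · obtain ⟨q, hq, hs⟩ := ih hl
        exact ⟨q, hq.cons a, hs⟩

theorem grouped_append (a b : List ℕ) : Grouped (a ++ b) ↔
    Grouped a ∧ Grouped b ∧ ∀ x ∈ a, x ∈ b → a.getLast? = some x ∧ b.head? = some x := by
  induction a with
  | nil => simp [Grouped]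
  | cons c a ih =>
    simp only [List.cons_append, Grouped, ih]
    rcases a with _ | ⟨d, a⟩
    · simp [Grouped]; tauto
    · simp only [List.getLast?_cons_cons, List.cons_append, List.head?_cons, Option.some.injEq,
        List.mem_cons, List.mem_append]
      constructor
      · rintro ⟨h1, h2, h3, h4⟩
        refine ⟨⟨fun h => h1 (by tauto), h2⟩, h3, ?_⟩
        rintro x (rfl | hx) hxb
        · have := h1 (by tauto)
          subst this
          exact h4 d (by simp) hxb
        · exact h4 x (by simpa using hx) hxb
      · rintro ⟨⟨h1, h2⟩, h3, h4⟩
        refine ⟨?_, h2, h3, fun x hx hxb => h4 x (by tauto) hxb⟩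
        rintro (h | h | h)
        · exact h1 (Or.inl h)
        · exact h1 (Or.inr h)
        · have := (h4 c (by simp) h).1
          exact h1 (by simpa using List.mem_of_getLast? this)

theorem Grouped.duplicate {a l : List ℕ} {x : ℕ} (h : Grouped (a ++ x :: l)) :
    Grouped (a ++ x :: x :: l) := by
  rw [grouped_append] at h ⊢
  obtain ⟨h1, h2, h3⟩ := h
  exact ⟨h1, ⟨by simp, h2⟩, fun y hy hyl => h3 y hy (by simpa using hyl)⟩

theorem sublist_sortAux (w s : List ℕ) : s.Sublist (sortAux abaPat w s) := by
  induction w generalizing s with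
  | nil => simp [sortAux]
  | cons x w ihw =>
    induction s with
    | nil => simp
    | cons t s ih =>
      rw [sortAux]
      split_ifs
      · exact ih.cons_cons t
      · exact (List.sublist_cons_self x _).trans (ihw _)

theorem sortAux_cons_of_notMem {x : ℕ} {s : List ℕ} (hs : Grouped s) (hx : x ∉ s) (w : List ℕ) :
    sortAux abaPat (x :: w) s = sortAux abaPat w (x :: s) := by
  rw [sortAux.eq_def]
  simp only
  rw [if_neg]
  rw [containsPat_aba_iff, not_not]
  exact ⟨fun h => absurd h hx, hs⟩

theorem sortAux_cons_of_mem {x : ℕ} {s : List ℕ} (hs : Grouped s) (hx : x ∈ s) (w : List ℕ) :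
    sortAux abaPat (x :: w) s = s.takeWhile (· ≠ x) ++
      sortAux abaPat w (x :: s.dropWhile (· ≠ x)) := by
  induction s with
  | nil => simp at hx
  | cons t s ih =>
    by_cases ht : t = x
    · subst ht
      rw [sortAux, if_neg]
      · simp
      rw [containsPat_aba_iff, not_not]
      exact ⟨by simp, hs⟩
    · rw [sortAux, if_pos]
      · rw [ih hs.2 (by simpa [Ne.symm ht] using hx)]
        simp [ht]
      rw [containsPat_aba_iff]
      intro h
      exact ht (by simpa using h.1 hx)

/-- Words of length `n` that extend a standardized word whose entries fill `{0, …, m - 1}`. -/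
def words : ℕ → ℕ → Finset (List ℕ)
  | 0, _ => {[]}
  | n + 1, m => (Finset.range (m + 1)).biUnion fun x =>
      (words n (max m (x + 1))).image (List.cons x)

theorem mem_words (n : ℕ) (w pre : List ℕ) :
    w ∈ words n (pre.foldr (fun a b => max (a + 1) b) 0) ↔ w.length = n ∧
      ∀ i : Fin w.length, w.get i ≤ (pre ++ w.take i).foldr (fun a b => max (a + 1) b) 0 := by
  have hfold : ∀ (l : List ℕ) (x : ℕ), (l ++ [x]).foldr (fun a b => max (a + 1) b) 0 =
      max (l.foldr (fun a b => max (a + 1) b) 0) (x + 1) := by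
    intro l x
    induction l with
    | nil => simp
    | cons c l ih =>
      rw [List.cons_append, List.foldr_cons, ih, List.foldr_cons, max_assoc]
  induction n generalizing w pre with
  | zero =>
    simp only [words, Finset.mem_singleton, List.length_eq_zero_iff]
    constructor
    · rintro rfl
      exact ⟨rfl, fun i => i.elim0⟩
    · exact fun h => h.1
  | succ n ih =>
    rcases w with _ | ⟨x, w⟩
    · simp [words]
    have key : (x :: w ∈ words (n + 1) (pre.foldr (fun a b => max (a + 1) b) 0)) ↔
        x ≤ pre.foldr (fun a b => max (a + 1) b) 0 ∧
          w ∈ words n (max (pre.foldr (fun a b => max (a + 1) b) 0) (x + 1)) := by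
      simp [words]
    have ih := ih w (pre ++ [x])
    rw [hfold] at ih
    rw [key, and_congr_right_iff.2 fun _ => ih]
    simp only [List.length_cons, Nat.add_right_cancel_iff]
    constructor
    · rintro ⟨h1, h2, h3⟩
      refine ⟨h2, fun i => ?_⟩
      refine Fin.cases ?_ (fun j => ?_) i
      · simpa using h1
      · simpa using h3 j
    · rintro ⟨h2, h3⟩
      refine ⟨by simpa using h3 0, h2, fun j => ?_⟩
      simpa using h3 j.succ

theorem card_filter_words_succ (n m : ℕ) (Q : List ℕ → Prop) :
    ((words (n + 1) m).filter Q).card = ∑ x ∈ Finset.range (m + 1),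
      ((words n (max m (x + 1))).filter fun w => Q (x :: w)).card := by
  rw [words, Finset.filter_biUnion, Finset.card_biUnion]
  · refine Finset.sum_congr rfl fun x _ => ?_
    rw [Finset.filter_image, Finset.card_image_of_injective _ (List.cons_injective)]
  · intro x _ y _ hxy
    rw [Function.onFun, Finset.disjoint_left]
    intro w hw hw'
    simp only [Finset.mem_filter, Finset.mem_image] at hw hw'
    obtain ⟨⟨u, _, rfl⟩, _⟩ := hw
    obtain ⟨⟨v, _, hv⟩, _⟩ := hw'
    exact hxy (by simpa using (List.cons.inj hv).1.symm)

/-- The number of standardized continuations of length `n` that are sorted by the procedure when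
it has already produced the output `o` and holds the stack `s`. -/
noncomputable def continuationCount (o s : List ℕ) (m n : ℕ) : ℕ :=
  ((words n m).filter fun w => Grouped (o ++ sortAux abaPat w s)).card

theorem sCount_eq_continuationCount (n : ℕ) : sCount n = continuationCount [] [] 0 n := by
  rw [sCount, continuationCount, ← Set.ncard_coe_finset]
  congr 1
  ext w
  have := mem_words n w []
  simp only [List.foldr_nil, List.nil_append] at this
  simp only [Set.mem_ofPred_eq, Finset.coe_filter, this, Standardized, sortedSocks_iff_grouped, phi,
    List.nil_append, and_assoc]

theorem continuationCount_zero {o s : List ℕ} (m : ℕ) (h : Grouped (o ++ s)) :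
    continuationCount o s m 0 = 1 := by
  simp [continuationCount, words, sortAux, Finset.filter_singleton, h]

theorem continuationCount_eq_zero {o s : List ℕ} (m n : ℕ) (h : ¬ Grouped (o ++ s)) :
    continuationCount o s m n = 0 := by
  rw [continuationCount, Finset.card_eq_zero, Finset.filter_eq_empty_iff]
  exact fun w _ hw => h (hw.sublist ((sublist_sortAux w s).append_left o))

theorem continuationCount_succ (o : List ℕ) {s : List ℕ} (m n : ℕ) (hs : Grouped s) :
    continuationCount o s m (n + 1) = ∑ x ∈ Finset.range (m + 1),
      if x ∈ s then continuationCount (o ++ s.takeWhile (· ≠ x)) (x :: s.dropWhile (· ≠ x))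
        (max m (x + 1)) n
      else continuationCount o (x :: s) (max m (x + 1)) n := by
  rw [continuationCount, card_filter_words_succ]
  refine Finset.sum_congr rfl fun x _ => ?_
  split_ifs with hx
  · simp only [sortAux_cons_of_mem hs hx, continuationCount, List.append_assoc]
  · simp only [sortAux_cons_of_notMem hs hx, continuationCount]

theorem sum_card_dropWhile {s : List ℕ} (hs : Grouped s) (f : ℕ → ℤ) :
    ∑ x ∈ s.toFinset, f (s.dropWhile (· ≠ x)).toFinset.card =
      ∑ j ∈ Finset.range s.toFinset.card, f (j + 1) := by
  induction s with
  | nil => simp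
  | cons a s ih =>
    have ih := ih hs.2
    have hne : ∀ x ∈ s.toFinset, x ≠ a → (a :: s).dropWhile (· ≠ x) = s.dropWhile (· ≠ x) := by
      intro x _ hxa
      simp [hxa.symm]
    by_cases ha : a ∈ s
    · have hins : (a :: s).toFinset = s.toFinset := by simp [ha]
      rw [hins, ← ih]
      refine Finset.sum_congr rfl fun x hx => ?_
      by_cases hxa : x = a
      · subst hxa
        obtain ⟨t, rfl⟩ : ∃ t, s = x :: t := by
          have := hs.1 ha
          rcases s with _ | ⟨b, t⟩
          · simp at ha
          · exact ⟨t, by simpa using this⟩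
        simp
      · rw [hne x hx hxa]
    · have ha' : a ∉ s.toFinset := by simpa using ha
      rw [List.toFinset_cons, Finset.sum_insert ha', Finset.card_insert_of_notMem ha',
        Finset.sum_range_succ, ← ih, add_comm]
      congr 1
      · refine Finset.sum_congr rfl fun x hx => ?_
        rw [hne x hx (by rintro rfl; exact ha' hx)]
      · simp [Finset.card_insert_of_notMem ha']

theorem continuationCount_of_mem {o s : List ℕ} {m n x : ℕ} {S U : ℕ → ℤ} {d : ℕ}
    (hos : Grouped (o ++ s)) (hm : ∀ x, x < m ↔ x ∈ o ++ s) (hx : x ∈ s)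
    (hd : s.toFinset.card = d + 1)
    (hS : s.head? = some x → ∀ s', s'.head? = some x → Grouped (o ++ s') →
      (∀ y, y < m ↔ y ∈ o ++ s') → s'.toFinset.card = d + 1 →
      (continuationCount o s' m n : ℤ) = S d)
    (hU : ∀ o' s' e, Grouped (o' ++ s') → (∀ y, y < m ↔ y ∈ o' ++ s') →
      s'.toFinset.card = e + 1 → o' ≠ [] → o'.getLast? ≠ s'.head? →
      (continuationCount o' s' m n : ℤ) = U e) :
    (continuationCount (o ++ s.takeWhile (· ≠ x)) (x :: s.dropWhile (· ≠ x))
      (max m (x + 1)) n : ℤ) =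
      if s.head? = some x then S d else U ((s.dropWhile (· ≠ x)).toFinset.card - 1) := by
  have hxm : x < m := (hm x).2 (by simp [hx])
  rw [max_eq_left (by omega : x + 1 ≤ m)]
  obtain ⟨r, hr⟩ : ∃ r, s.dropWhile (· ≠ x) = x :: r := by
    clear hos hm hd hS hU
    induction s with
    | nil => simp at hx
    | cons a s ih =>
      by_cases ha : a = x
      · exact ⟨s, by simp [ha]⟩
      · simpa [ha] using ih (by simpa [Ne.symm ha] using hx)
  have hsplit : s.takeWhile (· ≠ x) ++ x :: r = s := by
    rw [← hr]; exact List.takeWhile_append_dropWhile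
  have htw : x ∉ s.takeWhile (· ≠ x) := by
    intro h
    have := List.mem_takeWhile_imp h
    simp at this
  rw [hr]
  generalize s.takeWhile (· ≠ x) = t at *
  subst hsplit
  have hg : Grouped ((o ++ t) ++ x :: x :: r) := by
    apply Grouped.duplicate
    simpa using hos
  have hmem : ∀ y, y < m ↔ y ∈ (o ++ t) ++ x :: x :: r := by
    intro y
    rw [hm]
    simp
  rcases t with _ | ⟨b, t⟩
  · simp only [List.append_nil, List.nil_append, List.head?_cons, if_true] at *
    exact hS (by simp) _ rfl hg hmem (by simpa using hd)
  · have hb : b ≠ x := by rintro rfl; simp at htw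
    rw [if_neg (by simpa using hb)]
    refine hU _ _ _ hg hmem ?_ (by simp) ?_
    · have : 0 < (x :: r).toFinset.card := Finset.card_pos.2 ⟨x, by simp⟩
      rw [Nat.sub_add_cancel this]
      simp
    · rw [List.getLast?_append_of_ne_nil _ (by simp), List.head?_cons]
      exact fun h => htw (List.mem_of_getLast? h)

open PowerSeries in
theorem continuationCount_eq_coeff {V U L : ℕ → PowerSeries ℤ}
    (hV : ∀ d, V d = 1 + X * (V d + V (d + 1) + ∑ j ∈ Finset.range d, U j))
    (hU : ∀ d, U d = 1 + X * (U d + U (d + 1) + L (d + 1) + ∑ j ∈ Finset.range d, U j))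
    (hL : ∀ d, L d = 1 + X * (L d + ∑ j ∈ Finset.range d, U j)) (n : ℕ) :
    ∀ (o s : List ℕ) (m d : ℕ), Grouped (o ++ s) → (∀ x, x < m ↔ x ∈ o ++ s) →
      s.toFinset.card = d + 1 → (continuationCount o s m n : ℤ) =
        coeff n (if o = [] then V d else if o.getLast? = s.head? then L d else U d) := by
  induction n with
  | zero =>
    intro o s m d hos _ _
    rw [continuationCount_zero m hos]
    split_ifs
    · rw [hV]; simp
    · rw [hL]; simp
    · rw [hU]; simp
  | succ n ih =>
    intro o s m d hos hm hd
    obtain ⟨h, t, rfl⟩ : ∃ h t, s = h :: t := by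
      rcases s with _ | ⟨h, t⟩
      · simp at hd
      · exact ⟨h, t, rfl⟩
    set s := h :: t with hsdef
    have hhs : h ∈ s := by simp [hsdef]
    obtain ⟨hgo, hgs, hdisj⟩ := (grouped_append o s).1 hos
    have hms : m ∉ s := fun hms => by simpa using (hm m).2 (by simp [hms])
    have hmo : m ∉ o := fun hmo => by simpa using (hm m).2 (by simp [hmo])
    have hrange : Finset.range m = (o.toFinset \ s.toFinset) ∪ s.toFinset := by
      ext x
      simp [hm]
    rw [continuationCount_succ o m n hgs, Finset.sum_range_succ, if_neg hms, hrange,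
      Finset.sum_union Finset.sdiff_disjoint]
    rw [Nat.cast_add, Nat.cast_add, Nat.cast_sum, Nat.cast_sum]
    set K : ℕ → PowerSeries ℤ := fun d =>
      if o = [] then V d else if o.getLast? = s.head? then L d else U d with hK
    -- the terms for socks on the stack
    have hstack : ∑ x ∈ s.toFinset, ((if x ∈ s then
        continuationCount (o ++ s.takeWhile (· ≠ x)) (x :: s.dropWhile (· ≠ x)) (max m (x + 1)) n
        else continuationCount o (x :: s) (max m (x + 1)) n : ℕ) : ℤ) =
        coeff n (K d) + ∑ j ∈ Finset.range d, coeff n (U j) := by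
      have hterm : ∀ x ∈ s.toFinset, ((if x ∈ s then
          continuationCount (o ++ s.takeWhile (· ≠ x)) (x :: s.dropWhile (· ≠ x))
            (max m (x + 1)) n
          else continuationCount o (x :: s) (max m (x + 1)) n : ℕ) : ℤ) =
          if s.head? = some x then coeff n (K d)
          else coeff n (U ((s.dropWhile (· ≠ x)).toFinset.card - 1)) := by
        intro x hx
        have hx : x ∈ s := by simpa using hx
        rw [if_pos hx]
        refine continuationCount_of_mem (S := fun d => coeff n (K d))
          (U := fun d => coeff n (U d)) hos hm hx hd ?_ ?_
        · intro hh s' hs' hg hm' hd'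
          rw [ih o s' m d hg hm' hd', hs', ← hh]
        · intro o' s' e hg hm' hd' ho' hl
          rw [ih o' s' m e hg hm' hd', if_neg ho', if_neg hl]
      rw [Finset.sum_congr rfl hterm]
      have hsum := sum_card_dropWhile hgs fun k => coeff n (U (k - 1))
      have hhs' : h ∈ s.toFinset := by simpa using hhs
      rw [← Finset.add_sum_erase _ _ hhs'] at hsum ⊢
      have hdrop : s.dropWhile (· ≠ h) = s := by simp [hsdef]
      rw [hdrop, hd, Finset.sum_range_succ, add_comm, add_right_cancel_iff] at hsum
      simp only [Nat.add_sub_cancel] at hsum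
      rw [← hsum, if_pos (by simp [hsdef])]
      congr 1
      refine Finset.sum_congr rfl fun x hx => ?_
      rw [if_neg]
      simpa [hsdef] using (Finset.ne_of_mem_erase hx).symm
    rw [hstack]
    have hfresh : ∀ x, x ∉ s → (x ∈ o → o.getLast? = some x) → o.getLast? ≠ s.head? →
        Grouped (o ++ x :: s) := by
      intro x hxs hxo hl
      refine (grouped_append _ _).2 ⟨hgo, ⟨fun h => absurd h hxs, hgs⟩, fun y hy hys => ?_⟩
      rcases List.mem_cons.1 hys with rfl | hys
      · exact ⟨hxo hy, rfl⟩
      · obtain ⟨h1, h2⟩ := hdisj y hy hys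
        exact absurd (h1.trans h2.symm) hl
    have hcard : ∀ x, x ∉ s → (x :: s).toFinset.card = (d + 1) + 1 := by
      intro x hx
      rw [List.toFinset_cons, Finset.card_insert_of_notMem (by simpa using hx), hd]
    have hnew : (continuationCount o (m :: s) (max m (m + 1)) n : ℤ) =
        if o ≠ [] ∧ o.getLast? = s.head? then 0
        else coeff n (if o = [] then V (d + 1) else U (d + 1)) := by
      split_ifs with hc ho
      · rw [continuationCount_eq_zero, Nat.cast_zero]
        intro hg
        have hho : h ∈ o := List.mem_of_getLast? (hc.2.trans (by simp [hsdef]))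
        have := (((grouped_append _ _).1 hg).2.2 h hho (by simp [hhs])).2
        simp only [List.head?_cons, Option.some.injEq] at this
        exact hms (this ▸ hhs)
      all_goals
        rw [ih o (m :: s) (max m (m + 1)) (d + 1)
          (hfresh m hms (fun h => absurd h hmo) ?_) ?_ (hcard m hms)]
      · simp [ho]
      · simp [ho, hsdef]
      · intro x
        have := hm x
        simp only [List.mem_append, List.mem_cons] at this ⊢
        rw [max_eq_right (by omega), Nat.lt_succ_iff_lt_or_eq, this]
        tauto
      · rw [if_neg ho, if_neg]
        intro hl
        exact hmo (List.mem_of_getLast? (by simpa using hl))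
      · exact fun hl => hc ⟨ho, hl⟩
      · intro x
        have := hm x
        simp only [List.mem_append, List.mem_cons] at this ⊢
        rw [max_eq_right (by omega), Nat.lt_succ_iff_lt_or_eq, this]
        tauto
    -- the terms for socks that occur only in the output
    have hout : ∑ x ∈ o.toFinset \ s.toFinset, ((if x ∈ s then
        continuationCount (o ++ s.takeWhile (· ≠ x)) (x :: s.dropWhile (· ≠ x)) (max m (x + 1)) n
        else continuationCount o (x :: s) (max m (x + 1)) n : ℕ) : ℤ) =
        if o = [] ∨ o.getLast? = s.head? then 0 else coeff n (L (d + 1)) := by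
      have hterm : ∀ x ∈ o.toFinset \ s.toFinset, ((if x ∈ s then
          continuationCount (o ++ s.takeWhile (· ≠ x)) (x :: s.dropWhile (· ≠ x))
            (max m (x + 1)) n
          else continuationCount o (x :: s) (max m (x + 1)) n : ℕ) : ℤ) =
          if o.getLast? = some x then coeff n (L (d + 1)) else 0 := by
        intro x hx
        simp only [Finset.mem_sdiff, List.mem_toFinset] at hx
        obtain ⟨hxo, hxs⟩ := hx
        rw [if_neg hxs]
        split_ifs with hl
        · have hlh : o.getLast? ≠ s.head? := by
            rw [hl]
            intro hh
            exact hxs (List.mem_of_mem_head? (by simp [← hh]))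
          rw [ih o (x :: s) _ (d + 1) (hfresh x hxs (fun _ => hl) hlh) ?_ (hcard x hxs),
            if_neg (List.ne_nil_of_mem hxo), if_pos (by simpa using hl)]
          intro y
          have hxm := (hm x).2 (by simp [hxo])
          rw [max_eq_left (by omega), hm y]
          simp only [List.mem_append, List.mem_cons]
          constructor
          · tauto
          · rintro (h | rfl | h) <;> tauto
        · rw [continuationCount_eq_zero, Nat.cast_zero]
          intro hg
          exact hl (((grouped_append _ _).1 hg).2.2 x hxo (by simp)).1
      rw [Finset.sum_congr rfl hterm]
      split_ifs with hc
      · refine Finset.sum_eq_zero fun x hx => if_neg fun hl => ?_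
        simp only [Finset.mem_sdiff, List.mem_toFinset] at hx
        rcases hc with rfl | hc
        · simp at hl
        · exact hx.2 (List.mem_of_mem_head? (by simp [← hc, hl]))
      · push Not at hc
        obtain ⟨y, hy⟩ : ∃ y, o.getLast? = some y :=
          ⟨_, List.getLast?_eq_some_getLast hc.1⟩
        have hyo : y ∈ o := List.mem_of_getLast? hy
        have hys : y ∉ s := fun hys => hc.2 (hy.trans (hdisj y hyo hys).2.symm)
        rw [Finset.sum_eq_single y]
        · simp [hy]
        · intro x _ hxy
          rw [if_neg]
          rw [hy]
          simpa using hxy.symm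
        · intro h
          simp [hyo, hys] at h
    rw [hout, hnew, hK]
    have hcoeff : ∀ F G : PowerSeries ℤ, F = 1 + X * G → coeff (n + 1) F = coeff n G := by
      rintro F G rfl
      simp [coeff_succ_X_mul, coeff_one]
    by_cases ho : o = []
    · simp only [ho, true_or, if_true, ne_eq, not_true_eq_false, false_and, if_false]
      rw [hcoeff _ _ (hV d), map_add, map_add, map_sum]
      ring
    by_cases hl : o.getLast? = s.head?
    · simp only [ho, hl, or_true, if_true, ne_eq, not_false_eq_true, and_true, if_false]
      rw [hcoeff _ _ (hL d), map_add, map_sum]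
      ring
    · simp only [ho, hl, or_false, and_false, if_false]
      rw [hcoeff _ _ (hU d), map_add, map_add, map_add, map_sum]
      ring

open PowerSeries in
theorem exists_powerSeries_fixedPoint {R : Type*} [CommRing R] (G : PowerSeries R → PowerSeries R)
    (hG : ∀ u v, X * (u - v) ∣ G u - G v) : ∃ W, W = G W := by
  set a : ℕ → PowerSeries R := fun n => G^[n] 0
  have hsucc : ∀ n, a (n + 1) = G (a n) := fun n => Function.iterate_succ_apply' G n 0
  have hstep : ∀ n, (X : PowerSeries R) ^ n ∣ a (n + 1) - a n := by
    intro n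
    induction n with
    | zero => simp
    | succ n ih =>
      rw [hsucc (n + 1)]
      nth_rewrite 2 [hsucc n]
      rw [pow_succ']
      exact (mul_dvd_mul_left X ih).trans (hG _ _)
  have hconst : ∀ k j, coeff k (a (k + 1 + j)) = coeff k (a (k + 1)) := by
    intro k j
    induction j with
    | zero => rfl
    | succ j ih =>
      have := X_pow_dvd_iff.1 (hstep (k + 1 + j)) k (by omega)
      rw [map_sub, sub_eq_zero] at this
      rw [← ih, ← this]
      rfl
  set W : PowerSeries R := mk fun k => coeff k (a (k + 1)) with hW
  have hWa : ∀ n, (X : PowerSeries R) ^ n ∣ W - a n := by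
    intro n
    refine X_pow_dvd_iff.2 fun k hk => ?_
    obtain ⟨j, rfl⟩ := Nat.exists_eq_add_of_le (Nat.succ_le_of_lt hk)
    rw [map_sub, hconst k j, hW, coeff_mk, sub_self]
  refine ⟨W, ?_⟩
  ext k
  have h1 := X_pow_dvd_iff.1 (hWa (k + 1 + 1)) k (by omega)
  have h2 := X_pow_dvd_iff.1 (((hWa (k + 1)).trans (dvd_mul_left _ X)).trans (hG W (a (k + 1))))
    k (by omega)
  rw [map_sub, sub_eq_zero] at h1 h2
  rw [h1, h2, hsucc]

open PowerSeries in
/-- The generating function `P(x) = Σ_{n ≥ 1} s(n) xⁿ` of `1`-stack-sortable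
sock patterns under `φ_{aba}` satisfies
`2x(1-x)·P² - (1-3x+3x²)·P + x(1-x) = 0` in `ℤ⟦x⟧`, which is equivalent to the
closed form `P(x) = [(-1+3x-3x²) + √(1-6x+7x²-2x³+x⁴)]/(4(x²-x))`. -/
theorem generating_function_identity :
    let P : PowerSeries ℤ :=
      PowerSeries.mk fun n => if n = 0 then 0 else (sCount n : ℤ)
    2 * (X * (1 - X)) * P ^ 2 - (1 - 3 * X + 3 * X ^ 2) * P
      + X * (1 - X) = 0 := by
  intro P
  obtain ⟨W, hW⟩ := exists_powerSeries_fixedPoint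
    (fun W : PowerSeries ℤ => 1 + X * ((3 - X) * W + X * (1 - X) * W ^ 2))
    fun u v => ⟨(3 - X) + X * (1 - X) * (u + v), by ring⟩
  obtain ⟨l, hl⟩ : ∃ l : PowerSeries ℤ, l = 1 + X * W := ⟨_, rfl⟩
  obtain ⟨A, hA⟩ : ∃ A : PowerSeries ℤ, (1 - X) * A = 1 :=
    (isUnit_iff_constantCoeff.2 (by simp)).exists_right_inv
  obtain ⟨B, hB⟩ : ∃ B : PowerSeries ℤ, (1 - X - X * l) * B = 1 :=
    (isUnit_iff_constantCoeff.2 (by simp)).exists_right_inv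
  have hsum : ∀ d, X * ∑ j ∈ Finset.range d, l ^ j * W = l ^ d - 1 := by
    intro d
    induction d with
    | zero => simp
    | succ d ih =>
      rw [Finset.sum_range_succ, mul_add, ih]
      linear_combination -l ^ d * hl
  have hWA : W = X * W + X * l * W + X * l * A + 1 := by
    have h0 : (1 - X) * (W - (X * W + X * l * W + X * l * A + 1)) = 0 := by
      rw [hl]
      linear_combination hW - X * (1 + X * W) * hA
    have h1 : W - (X * W + X * l * W + X * l * A + 1) = 0 := by
      linear_combination A * h0 - (W - (X * W + X * l * W + X * l * A + 1)) * hA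
    linear_combination h1
  have hcount := continuationCount_eq_coeff (V := fun d => l ^ d * B) (U := fun d => l ^ d * W)
    (L := fun d => l ^ d * A)
    (fun d => by linear_combination l ^ d * hB - hsum d)
    (fun d => by linear_combination l ^ d * hWA - hsum d)
    (fun d => by linear_combination l ^ d * hA - hsum d)
  have hP : P = X * B := by
    ext n
    rcases n with _ | n
    · simp [P]
    · rw [coeff_succ_X_mul, coeff_mk, if_neg n.succ_ne_zero, sCount_eq_continuationCount,
        continuationCount_succ [] (s := []) 0 n trivial]
      simpa using hcount n [] [0] 1 0 (by simp [Grouped]) (by simp) (by simp)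
  rw [hP]
  rw [hl] at hB
  linear_combination (-X ^ 3 * B ^ 2) * hW
    + (X * (1 - 3 * X + 3 * X ^ 2) * B - X * (1 - X) * ((1 - X - X * (1 + X * W)) * B + 1)) * hB
end

section
/- Let p be a sock sequence containing exactly n distinct socks. Then the n-th iterate φ_{aba}^n(p) is sorted; that is, every sock sequence on n distinct socks is n-stack-sortable under φ_{aba}. In particular, every sock sequence becomes sorted after finitely many iterations of φ_{aba}. -/
attribute [local instance] Classical.propDecidable

/-- The occurrences of `x` in `l` are consecutive. -/
def Clumped {A : Type*} (x : A) (l : List A) : Prop :=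
  ∀ y, y ≠ x → ¬ [x, y, x].Sublist l

section Clumped

variable {A : Type*} {x y : A} {l u v : List A}

theorem Clumped.sublist (h : Clumped x l) (hu : u.Sublist l) : Clumped x u :=
  fun y hy hs => h y hy (hs.trans hu)

theorem clumped_of_notMem (h : x ∉ l) : Clumped x l :=
  fun _ _ hs => h (hs.subset (by simp))

theorem Clumped.reverse (h : Clumped x l) : Clumped x l.reverse := by
  intro y hy hs
  exact h y hy (by simpa using hs.reverse)

theorem Clumped.append_of_notMem_left (hu : x ∉ u) (h : Clumped x v) :
    Clumped x (u ++ v) := by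
  induction u with
  | nil => exact h
  | cons a u ih =>
    simp only [List.mem_cons, not_or] at hu
    intro y hy hs
    rw [List.cons_append, List.sublist_cons_iff] at hs
    rcases hs with hs | ⟨r, hr, -⟩
    · exact ih hu.2 y hy hs
    · exact hu.1 (List.cons.inj hr).1

theorem Clumped.append_of_notMem_right (hv : x ∉ v) (h : Clumped x u) :
    Clumped x (u ++ v) := by
  have := (Clumped.append_of_notMem_left (u := v.reverse) (by simpa using hv) h.reverse).reverse
  simpa using this

theorem Clumped.cons_self (h : Clumped x (x :: l)) : Clumped x (x :: x :: l) := by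
  intro y hy hs
  rw [List.sublist_cons_iff] at hs
  rcases hs with hs | ⟨r, hr, hs⟩
  · exact h y hy hs
  · obtain rfl := (List.cons.inj hr).2
    rw [List.sublist_cons_iff] at hs
    rcases hs with hs | ⟨r, hr, -⟩
    · exact h y hy (hs.cons_cons x)
    · exact hy (List.cons.inj hr).1

theorem Clumped.cons_of_ne (hxy : x ≠ y) (h : Clumped x l) : Clumped x (y :: l) :=
  Clumped.append_of_notMem_left (u := [y]) (by simpa using hxy) h

theorem Clumped.notMem_right (h : Clumped x (u ++ y :: v)) (hxy : y ≠ x) (hx : x ∈ u) :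
    x ∉ v := by
  intro hv
  refine h y hxy ?_
  have h1 : [x].Sublist u := List.singleton_sublist.2 hx
  have h2 : [x].Sublist v := List.singleton_sublist.2 hv
  exact h1.append (h2.cons_cons y)

theorem sortedSocks_of_forall_clumped (h : ∀ x, Clumped x l) : SortedSocks l := by
  intro i j k hij hjk hik
  by_contra hne
  have hi : i < l.length := by
    by_contra hi
    apply hne
    rw [List.getElem?_eq_none (by omega), List.getElem?_eq_none (by omega)]
  have hk : k < l.length := by
    by_contra hk
    rw [List.getElem?_eq_none (by omega : l.length ≤ k)] at hik
    simp at hik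
    omega
  have hj : j < l.length := by omega
  simp only [List.getElem?_eq_getElem, hi, hj, hk, Option.some.injEq] at hik hne
  have hij' : i < j := lt_of_le_of_ne hij (by rintro rfl; exact hne rfl)
  have hjk' : j < k := lt_of_le_of_ne hjk (by rintro rfl; exact hne hik.symm)
  refine h l[i] l[j] hne ?_
  have hs := List.map_getElem_sublist (l := l) (is := [⟨i, hi⟩, ⟨j, hj⟩, ⟨k, hk⟩])
    (by simp [hij', hjk', hij'.trans hjk'])
  simpa [← hik] using hs

theorem containsPat_abaPat_iff : ContainsPat l abaPat ↔ ∃ x, ¬ Clumped x l := by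
  simp only [Clumped, not_forall, not_not]
  constructor
  · rintro ⟨q, hq, hlen, hs⟩
    obtain ⟨a, b, c, rfl⟩ := List.length_eq_three.1 hlen
    have h1 := hs 0 1
    have h2 := hs 0 2
    simp only [abaPat] at h1 h2
    simp at h1 h2
    subst h2
    exact ⟨a, b, fun h => h1 h.symm, hq⟩
  · rintro ⟨x, y, hxy, hs⟩
    refine ⟨_, hs, rfl, ?_⟩
    intro i j
    have hyx := hxy.symm
    rcases i with _ | _ | _ | i <;> rcases j with _ | _ | _ | j <;> simp [abaPat, hxy, hyx]

end Clumped

section SortAux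

variable {A : Type*} {x b : A} {input s u v : List A}

theorem sortAux_perm {B : Type*} (σ : List B) (input s : List A) :
    (sortAux σ input s).Perm (input ++ s) := by
  fun_induction sortAux σ input s with
  | case1 s => simp
  | case2 x input h ih => exact ih.trans (by simp)
  | case3 x input t rest h ih =>
    exact (ih.cons t).trans (List.perm_middle.symm)
  | case4 x input s h ih => exact ih.trans List.perm_middle

theorem sortAux_push (h : ∀ y, Clumped y (x :: s)) :
    sortAux abaPat (x :: input) s = sortAux abaPat input (x :: s) := by
  rw [sortAux.eq_def]
  dsimp only
  rw [if_neg]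
  simpa [containsPat_abaPat_iff] using h

theorem clumped_cons_of_notMem (h : ∀ y, Clumped y s) (hx : x ∉ s) :
    ∀ y, Clumped y (x :: s) := by
  intro y
  by_cases hy : y = x
  · subst hy
    exact Clumped.append_of_notMem_right (u := [y]) hx
      (fun z _ hs => by simpa using hs.length_le)
  · exact (h y).cons_of_ne hy

theorem clumped_cons_self (h : ∀ y, Clumped y (x :: s)) : ∀ y, Clumped y (x :: x :: s) := by
  intro y
  by_cases hy : y = x
  · subst hy
    exact (h y).cons_self
  · exact (h y).cons_of_ne hy

theorem sortAux_pop (h : ∀ y, Clumped y (u ++ x :: v)) (hx : x ∉ u) :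
    sortAux abaPat (x :: input) (u ++ x :: v) = u ++ sortAux abaPat input (x :: x :: v) := by
  induction u with
  | nil => exact sortAux_push (clumped_cons_self h)
  | cons a u ih =>
    simp only [List.mem_cons, not_or] at hx
    rw [List.cons_append, sortAux, if_pos, List.cons_append,
      ih (fun y => (h y).sublist (List.sublist_cons_self _ _)) hx.2]
    rw [containsPat_abaPat_iff]
    refine ⟨x, fun hc => hc a (Ne.symm hx.1) ?_⟩
    exact ((List.singleton_sublist.2 (by simp)).cons_cons a).cons_cons x

theorem sortAux_append (w : List A) (h : ∀ y, Clumped y (w.reverse ++ s)) :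
    sortAux abaPat (w ++ input) s = sortAux abaPat input (w.reverse ++ s) := by
  induction w generalizing s with
  | nil => rfl
  | cons a w ih =>
    have h' : ∀ y, Clumped y (w.reverse ++ a :: s) := by simpa using h
    rw [List.cons_append, sortAux_push fun y => (h' y).sublist (List.sublist_append_right _ _),
      ih h']
    simp

/-- A clumped sock stays clumped. -/
theorem Clumped.sortAux (hs : ∀ y, Clumped y s) (hb : Clumped b (s.reverse ++ input)) :
    Clumped b (sortAux abaPat input s) := by
  induction input generalizing s with
  | nil => simpa [_root_.sortAux] using hs b
  | cons x input ih =>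
    by_cases hx : x ∈ s
    · obtain ⟨u, v, rfl, hxu⟩ := List.eq_append_cons_of_mem hx
      have h := clumped_cons_self fun y => (hs y).sublist (List.sublist_append_right u (x :: v))
      rw [sortAux_pop hs hxu]
      by_cases hbu : b ∈ u
      · have hbx : x ≠ b := by rintro rfl; exact hxu hbu
        have hbv : b ∉ v := (hs b).notMem_right hbx hbu
        have hbi : b ∉ input :=
          Clumped.notMem_right (u := (u ++ x :: v).reverse) hb hbx (by simp [hbu])
        refine Clumped.append_of_notMem_right ?_ ((hs b).sublist (List.sublist_append_left _ _))
        rw [(sortAux_perm _ _ _).mem_iff]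
        simp [hbv, hbi, hbx.symm]
      · refine Clumped.append_of_notMem_left hbu (ih h (hb.sublist ?_))
        simp
    · have h := clumped_cons_of_notMem hs hx
      rw [sortAux_push h]
      exact ih h (by simpa using hb)

/-- If no sock below some copy of `b` in the stack appears in the input, then `b` is clumped in
the output. -/
theorem clumped_sortAux_of_suffix (hs : ∀ y, Clumped y s) (hsuf : b :: v <:+ s)
    (hv : ∀ y ∈ v, y ∉ input) : Clumped b (sortAux abaPat input s) := by
  induction input generalizing s with
  | nil => simpa [sortAux] using hs b
  | cons x input ih =>
    have hvi : ∀ y ∈ v, y ∉ input := fun y hy hi => hv y hy (by simp [hi])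
    by_cases hx : x ∈ s
    · obtain ⟨u, w, rfl, hxu⟩ := List.eq_append_cons_of_mem hx
      have h := clumped_cons_self fun y => (hs y).sublist (List.sublist_append_right u (x :: w))
      have hxv : x ∉ v := fun hxv => hv x hxv (by simp)
      have hsuf' : b :: v <:+ x :: w := by
        rcases List.suffix_or_suffix_of_suffix hsuf (List.suffix_append u (x :: w)) with h | h
        · exact h
        · rcases List.suffix_cons_iff.1 h with h | h
          · rw [h]
          · exact absurd (h.subset (by simp)) hxv
      have hbw : b ∈ x :: w := hsuf'.subset (by simp)
      have hbu : b ∉ u := by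
        intro hbu
        have hbx : x ≠ b := by rintro rfl; exact hxu hbu
        exact (hs b).notMem_right hbx hbu (List.mem_of_ne_of_mem hbx.symm hbw)
      rw [sortAux_pop hs hxu]
      exact Clumped.append_of_notMem_left hbu
        (ih h (hsuf'.trans (List.suffix_cons _ _)) hvi)
    · have h := clumped_cons_of_notMem hs hx
      rw [sortAux_push h]
      exact ih h (hsuf.trans (List.suffix_cons _ _)) hvi

/-- The first sock whose occurrences are not consecutive becomes clumped. -/
theorem clumped_phi_of_first {l r : List A} (hl : ∀ y ∈ l, Clumped y (l ++ b :: r))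
    (hb : b ∉ l) : Clumped b (phi abaPat (l ++ b :: r)) := by
  have hc : ∀ y, Clumped y l := fun y => by
    by_cases hy : y ∈ l
    · exact (hl y hy).sublist (List.sublist_append_left _ _)
    · exact clumped_of_notMem hy
  have hc' : ∀ y, Clumped y (b :: l.reverse) :=
    clumped_cons_of_notMem (fun y => (hc y).reverse) (by simpa using hb)
  rw [phi, sortAux_append l (by simpa using fun y => (hc y).reverse), List.append_nil,
    sortAux_push hc']
  refine clumped_sortAux_of_suffix hc' List.suffix_rfl fun y hy => ?_
  rw [List.mem_reverse] at hy
  exact (hl y hy).notMem_right (by rintro rfl; exact hb hy) hy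

end SortAux

theorem exists_clumped_phi {A : Type*} {p : List A} (h : ∃ x, ¬ Clumped x p) :
    ∃ b ∈ p, ¬ Clumped b p ∧ Clumped b (phi abaPat p) := by
  obtain ⟨x, hx⟩ := h
  have hxp : x ∈ p := by
    by_contra hxp
    exact hx (clumped_of_notMem hxp)
  obtain ⟨b, hb⟩ := Option.isSome_iff_exists.1
    (List.find?_isSome (p := fun x => decide (¬ Clumped x p)).2 ⟨x, hxp, by simpa using hx⟩)
  obtain ⟨hbp, l, r, hp, hl⟩ := List.find?_eq_some_iff_append.1 hb
  simp only [Bool.not_eq_true', decide_eq_false_iff_not, not_not, decide_eq_true_eq] at hbp hl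
  refine ⟨b, by simp [hp], hbp, ?_⟩
  rw [hp] at hl hbp ⊢
  exact clumped_phi_of_first hl fun hb => hbp (hl b hb)

theorem sortedSocks_iterate_phi {A : Type*} [DecidableEq A] (n : ℕ) (p : List A)
    (h : (p.toFinset.filter fun x => ¬ Clumped x p).card ≤ n) :
    SortedSocks ((phi abaPat)^[n] p) := by
  induction n generalizing p with
  | zero =>
    refine sortedSocks_of_forall_clumped fun x => ?_
    by_cases hx : x ∈ p
    · simp only [Nat.le_zero, Finset.card_eq_zero, Finset.filter_eq_empty_iff, not_not,
        List.mem_toFinset] at h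
      exact h hx
    · exact clumped_of_notMem hx
  | succ n ih =>
    rw [Function.iterate_succ_apply]
    apply ih
    have hperm : (phi abaPat p).Perm p := by simpa [phi] using sortAux_perm abaPat p []
    have hmono : ∀ x, Clumped x p → Clumped x (phi abaPat p) := fun x hx =>
      Clumped.sortAux (fun y => clumped_of_notMem (by simp)) (by simpa using hx)
    rw [List.toFinset_eq_of_perm _ _ hperm]
    have hsub : (p.toFinset.filter fun x => ¬ Clumped x (phi abaPat p)) ⊆
        p.toFinset.filter fun x => ¬ Clumped x p :=
      Finset.monotone_filter_right _ fun x _ hx hc => hx (hmono x hc)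
    by_cases hp : ∃ x, ¬ Clumped x p
    · obtain ⟨b, hbp, hb, hb'⟩ := exists_clumped_phi hp
      have : (p.toFinset.filter fun x => ¬ Clumped x (phi abaPat p)) ⊂
          p.toFinset.filter fun x => ¬ Clumped x p :=
        (Finset.ssubset_iff_of_subset hsub).2 ⟨b, by simp [hbp, hb], by simp [hb']⟩
      have := Finset.card_lt_card this
      omega
    · push Not at hp
      rw [Finset.filter_false_of_mem fun x _ => not_not.2 (hmono x (hp x))]
      simp

/-- Every sock sequence on `n` distinct socks is `n`-stack-sortable under
`φ_{aba}`; in particular, every sock sequence becomes sorted after finitely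
many iterations of `φ_{aba}`. -/
theorem sorted_after_n_iterations {A : Type*} [DecidableEq A]
    (p : List A) (n : ℕ) (hn : p.toFinset.card = n) :
    SortedSocks ((phi abaPat)^[n] p) ∧
      ∃ k : ℕ, SortedSocks ((phi abaPat)^[k] p) := by
  have h := sortedSocks_iterate_phi n p ((Finset.card_filter_le _ _).trans hn.le)
  exact ⟨h, n, h⟩
end

section
/- Let n ≥ 3 and let a_1, …, a_n be pairwise distinct socks. Then the sock sequence p = a_1 a_2 ⋯ a_n a_1 a_2 ⋯ a_n (each distinct sock appearing exactly twice) satisfies: φ_{aba}^{n−1}(p) is not sorted. Hence for every n ≥ 3 there is a sock sequence on n distinct socks that is not (n−1)-stack-sortable under φ_{aba}, so the upper bound of n iterations of φ_{aba} needed to sort a sequence on n distinct socks is tight. -/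
attribute [local instance] Classical.propDecidable

/-- A list contains the pattern `aba` iff it has a sublist `[x, y, x]` with `x ≠ y`. -/
theorem containsPat_abaPat_iff_s3 {A : Type*} (p : List A) :
    ContainsPat p abaPat ↔ ∃ x y, x ≠ y ∧ [x, y, x].Sublist p := by
  constructor
  · rintro ⟨q, hq, hlen, hpat⟩
    obtain ⟨x, y, z, rfl⟩ := List.length_eq_three.mp hlen
    have h₁ := hpat 0 1
    have h₂ := hpat 0 2
    simp only [abaPat, List.getElem?_cons_zero, List.getElem?_cons_succ, Option.some.injEq] at h₁ h₂
    obtain rfl : x = z := by simpa using h₂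
    exact ⟨x, y, by simpa using h₁, hq⟩
  · rintro ⟨x, y, hxy, hs⟩
    refine ⟨_, hs, rfl, fun i j => ?_⟩
    rcases i with _ | _ | _ | i <;> rcases j with _ | _ | _ | j <;>
      simp [abaPat, hxy, hxy.symm]

theorem ContainsPat.mono {A B : Type*} {p q : List A} {σ : List B} (hpq : p.Sublist q)
    (h : ContainsPat p σ) : ContainsPat q σ :=
  let ⟨r, hr, hs⟩ := h
  ⟨r, hr.trans hpq, hs⟩

/-- Every entry of the list is repeated twice in place. -/
def List.double {A : Type*} (l : List A) : List A :=
  l.flatMap fun x => [x, x]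

namespace List

variable {A : Type*}

@[simp] theorem double_nil : ([] : List A).double = [] := rfl

@[simp] theorem double_cons (x : A) (l : List A) : (x :: l).double = x :: x :: l.double := rfl

@[simp] theorem double_append (l m : List A) : (l ++ m).double = l.double ++ m.double := by
  simp [double]

@[simp] theorem mem_double {x : A} {l : List A} : x ∈ l.double ↔ x ∈ l := by
  simp [double]

theorem reverse_double (l : List A) : l.double.reverse = l.reverse.double := by
  induction l with
  | nil => rfl
  | cons x l ih => simp [ih]

theorem sublist_double (l : List A) : l.Sublist l.double := by
  induction l with
  | nil => exact Sublist.slnil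
  | cons x l ih => exact (ih.cons x).cons_cons x

end List

theorem not_containsPat_double {A : Type*} {l : List A} (h : l.Nodup) :
    ¬ ContainsPat l.double abaPat := by
  rw [containsPat_abaPat_iff_s3]
  rintro ⟨x, y, hxy, hs⟩
  induction l with
  | nil => simp at hs
  | cons z l ih =>
    rw [List.nodup_cons] at h
    by_cases hxz : x = z
    · subst hxz
      have hs' : [x, y, x].Sublist l.double ∨ [y, x].Sublist l.double := by
        simpa [List.sublist_cons_iff, hxy.symm] using hs
      have hs'' := hs'.elim List.sublist_of_cons_sublist id
      exact h.1 (List.mem_double.mp (hs''.subset (by simp)))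
    · apply ih h.2
      simpa [List.sublist_cons_iff, hxz] using hs

theorem sortAux_append_of_not_containsPat {A B : Type*} {σ : List B} (l input s : List A)
    (h : ¬ ContainsPat (l.reverse ++ s) σ) :
    sortAux σ (l ++ input) s = sortAux σ input (l.reverse ++ s) := by
  induction l generalizing s with
  | nil => rfl
  | cons x l ih =>
    have h' : ¬ ContainsPat (l.reverse ++ x :: s) σ := by simpa using h
    have hx : ¬ ContainsPat (x :: s) σ := fun hc => h' (hc.mono (List.sublist_append_right _ _))
    rw [List.cons_append, sortAux.eq_def]
    simp [hx, ih _ h']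

theorem sortAux_abaPat_pop {A : Type*} (x : A) (input l s : List A) (h : x ∉ l) :
    sortAux abaPat (x :: input) (l ++ x :: s) =
      l ++ sortAux abaPat (x :: input) (x :: s) := by
  induction l with
  | nil => rfl
  | cons t l ih =>
    rw [List.mem_cons, not_or] at h
    have hc : ContainsPat (x :: (t :: l ++ x :: s)) abaPat := by
      rw [containsPat_abaPat_iff_s3]
      refine ⟨x, t, h.1, ?_⟩
      simp
    rw [List.cons_append, sortAux, if_pos (by simpa using hc)]
    simp [ih h.2]

theorem phi_abaPat_step {A : Type*} (x : A) (u d v w : List A)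
    (h : (u ++ (x :: d) ++ v ++ w).Nodup) :
    phi abaPat (u.double ++ (x :: d) ++ v.double ++ (x :: d) ++ w.double) =
      v.reverse.double ++ d.reverse ++ w.reverse.double ++ d.reverse ++
        (x :: u.reverse).double := by
  have hpush : ¬ ContainsPat (v.reverse.double ++ d.reverse ++ x :: u.reverse.double) abaPat := by
    have hn : (v.reverse ++ d.reverse ++ x :: u.reverse).Nodup := by
      simp only [List.nodup_append, List.nodup_cons, List.nodup_reverse, List.mem_append,
        List.mem_reverse, List.mem_cons] at h ⊢
      grind
    refine fun hc => not_containsPat_double hn (hc.mono ?_)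
    simp only [List.double_append, List.double_cons]
    exact ((List.Sublist.refl _).append (List.sublist_double _)).append (List.sublist_cons_self _ _)
  have hpush' : ¬ ContainsPat
      (w.reverse.double ++ d.reverse ++ x :: x :: u.reverse.double) abaPat := by
    have hn : (w.reverse ++ d.reverse ++ x :: u.reverse).Nodup := by
      simp only [List.nodup_append, List.nodup_cons, List.nodup_reverse, List.mem_append,
        List.mem_reverse, List.mem_cons] at h ⊢
      grind
    refine fun hc => not_containsPat_double hn (hc.mono ?_)
    simp only [List.double_append, List.double_cons]
    exact ((List.Sublist.refl _).append (List.sublist_double _)).append (List.Sublist.refl _)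
  have hx : x ∉ v.reverse.double ++ d.reverse := by
    simp only [List.mem_append, List.mem_double, List.mem_reverse]
    grind
  have e₁ := sortAux_append_of_not_containsPat (σ := abaPat)
    (u.double ++ (x :: d) ++ v.double) (x :: (d ++ w.double)) []
    (by simpa [List.reverse_double] using hpush)
  have e₂ := sortAux_abaPat_pop x (d ++ w.double) _ u.reverse.double hx
  have e₃ := sortAux_append_of_not_containsPat (σ := abaPat)
    (x :: (d ++ w.double)) [] (x :: u.reverse.double)
    (by simpa [List.reverse_double] using hpush')
  simp only [List.append_assoc, List.cons_append, List.reverse_append, List.reverse_cons,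
    List.reverse_double, List.append_nil, List.nil_append, List.double_cons] at e₁ e₂ e₃ ⊢
  rw [phi, e₁, e₂, e₃, sortAux]

/-- The shape of the iterates: `n - k` socks remain separated after `k` passes. -/
theorem exists_iterate_phi_abaPat_eq {A : Type*} (l : List A) (hl : l.Nodup) (k : ℕ)
    (hk : k ≤ l.length) :
    ∃ u c v w : List A, (u ++ c ++ v ++ w).Nodup ∧ c.length + k = l.length ∧
      (1 ≤ k → w ≠ []) ∧ (2 ≤ k → v ≠ []) ∧
      (phi abaPat)^[k] (l ++ l) = u.double ++ c ++ v.double ++ c ++ w.double := by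
  induction k with
  | zero => exact ⟨[], l, [], [], by simpa using hl, rfl, by simp, by simp, by simp⟩
  | succ k ih =>
    obtain ⟨u, c, v, w, hn, hc, hw, -, he⟩ := ih (by omega)
    match c with
    | [] => simp at hc; omega
    | x :: d =>
      refine ⟨v.reverse, d.reverse, w.reverse, x :: u.reverse, ?_, ?_, by simp, ?_, ?_⟩
      · simp only [List.nodup_append, List.nodup_cons, List.nodup_reverse, List.mem_append,
          List.mem_reverse, List.mem_cons] at hn ⊢
        grind
      · simp at hc ⊢; omega
      · intro h
        simpa using hw (by omega)
      · rw [Function.iterate_succ_apply', he, phi_abaPat_step x u d v w hn]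

theorem SortedSocks.eq_of_append {A : Type*} {x y : A} {l m r : List A}
    (h : SortedSocks (l ++ x :: y :: m ++ x :: r)) : y = x := by
  simpa [List.getElem?_append] using
    h l.length (l.length + 1) (l.length + (m.length + 2)) (by omega) (by omega)
      (by simp)

/-- For `n ≥ 3` and pairwise distinct socks `a_1, …, a_n`, the sock sequence
`p = a_1 ⋯ a_n a_1 ⋯ a_n` is not `(n-1)`-stack-sortable under `φ_{aba}`:
`φ_{aba}^{n-1}(p)` is not sorted.  Hence the upper bound of `n` iterations is
tight. -/
theorem not_sorted_after_n_sub_one_iterations {A : Type*} (n : ℕ) (hn : 3 ≤ n)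
    (a : Fin n → A) (ha : Function.Injective a) :
    ¬ SortedSocks ((phi abaPat)^[n - 1] (List.ofFn a ++ List.ofFn a)) := by
  obtain ⟨u, c, v, w, hnd, hc, -, hv, he⟩ :=
    exists_iterate_phi_abaPat_eq (List.ofFn a) (List.nodup_ofFn.mpr ha) (n - 1) (by simp)
  rw [List.length_ofFn] at hc
  obtain ⟨x, rfl⟩ := List.length_eq_one_iff.mp (show c.length = 1 by omega)
  obtain ⟨y, t, rfl⟩ := List.exists_cons_of_ne_nil (hv (by omega))
  rw [he]
  intro hs
  have hyx : y = x := SortedSocks.eq_of_append (l := u.double) (m := y :: t.double)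
    (r := w.double) (by simpa using hs)
  subst hyx
  simp [List.nodup_append] at hnd
end

section
/- Let σ be any sock pattern of length at least 2 that is not equivalent to the pattern aba (i.e. σ is not an injective renaming of aba). Then there exists a sock sequence p such that for every k ≥ 0, the iterate φ_σ^k(p) is not sorted. Consequently, among patterns of length at least 2, aba is the only pattern σ for which φ_σ eventually sorts every sock sequence. -/
attribute [local instance] Classical.propDecidable

theorem ContainsPat.length_le {A B : Type*} {p : List A} {σ : List B} (h : ContainsPat p σ) :
    σ.length ≤ p.length := by
  obtain ⟨q, hq, hs, -⟩ := h
  exact hs ▸ hq.length_le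

theorem SameShape.symm {A B : Type*} {q : List A} {r : List B} (h : SameShape q r) :
    SameShape r q :=
  ⟨h.1.symm, fun i j => (h.2 i j).symm⟩

/-- Containment of a pattern of length two is the negation of a pairwise condition. -/
theorem containsPat_pair_iff {A B : Type*} (p : List A) (s t : B) :
    ContainsPat p [s, t] ↔ ¬ p.Pairwise (fun a b => ¬ (a = b ↔ s = t)) := by
  rw [List.pairwise_iff_forall_sublist]
  push Not
  constructor
  · rintro ⟨q, hq, hl, hs⟩
    obtain ⟨a, b, rfl⟩ := List.length_eq_two.mp hl
    exact ⟨a, b, hq, by simpa using hs 0 1⟩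
  · rintro ⟨a, b, hab, h⟩
    refine ⟨[a, b], hab, rfl, fun i j => ?_⟩
    rcases i with _ | _ | i <;> rcases j with _ | _ | j <;> simp [h, eq_comm (a := b), eq_comm (a := t)]

/-- A map preserving a set of unsorted sequences never sorts its members. -/
theorem not_sortedSocks_iterate {A : Type*} (f : List A → List A) (S : List (List A))
    (hf : ∀ p ∈ S, f p ∈ S) (hS : ∀ p ∈ S, ¬ SortedSocks p) {p : List A} (hp : p ∈ S) (k : ℕ) :
    ¬ SortedSocks (f^[k] p) := by
  refine hS _ ?_
  induction k with
  | zero => exact hp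
  | succ k ih => rw [Function.iterate_succ_apply']; exact hf _ ih

theorem not_sortedSocks_zero_one_zero : ¬ SortedSocks [0, 1, 0] := fun h => by
  simpa using h 0 1 2

theorem phi_eq_self_of_three_le {B : Type*} (σ : List B) (hlen : 3 ≤ σ.length)
    (hσ : ¬ SameShape σ abaPat) : phi σ [0, 1, 0] = [0, 1, 0] := by
  have h₁ : ¬ ContainsPat [0] σ := fun h => by have := h.length_le; simp at this; omega
  have h₂ : ¬ ContainsPat [1, 0] σ := fun h => by have := h.length_le; simp at this; omega
  have h₃ : ¬ ContainsPat [0, 1, 0] σ := by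
    rintro ⟨q, hq, hs⟩
    have hq' : q = abaPat := hq.eq_of_length_le (by simp [hs.1, hlen])
    exact hσ (hq' ▸ hs).symm
  simp [phi, sortAux, h₁, h₂, h₃]

theorem phi_eq_self_of_ne {B : Type*} {s t : B} (h : s ≠ t) :
    phi [s, t] [0, 1, 0] = [0, 1, 0] := by
  simp [phi, sortAux, containsPat_pair_iff, h]

theorem exists_never_sorted_pair_self {B : Type*} (s : B) :
    ∃ p : List ℕ, ∀ k : ℕ, ¬ SortedSocks ((phi [s, s])^[k] p) := by
  refine ⟨[0, 1, 2, 1, 2], not_sortedSocks_iterate _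
    [[0, 1, 2, 1, 2], [2, 1, 2, 1, 0], [1, 2, 0, 1, 2],
      [0, 2, 1, 2, 1], [1, 2, 1, 2, 0], [2, 1, 0, 2, 1]] ?_ ?_ (by simp)⟩
  · simp [phi, sortAux, containsPat_pair_iff]
  · simp only [List.forall_mem_cons, List.not_mem_nil, false_implies, implies_true, and_true]
    refine ⟨fun h => ?_, fun h => ?_, fun h => ?_, fun h => ?_, fun h => ?_, fun h => ?_⟩
    · simpa using h 1 2 3
    · simpa using h 0 1 2
    · simpa using h 0 1 3
    · simpa using h 1 2 3
    · simpa using h 0 1 2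
    · simpa using h 0 1 3

/-- For any pattern `σ` of length at least 2 that is not equivalent to `aba`
(i.e. not an injective renaming of `aba`), there is a sock sequence `p` no
iterate of which under `φ_σ` is ever sorted.  Consequently, among patterns of
length at least 2, `aba` is the only pattern whose stack-sorting map
eventually sorts every sock sequence. -/
theorem exists_never_sorted {B : Type*} (σ : List B) (hlen : 2 ≤ σ.length)
    (hσ : ¬ SameShape σ abaPat) :
    ∃ p : List ℕ, ∀ k : ℕ, ¬ SortedSocks ((phi σ)^[k] p) := by
  have fixed (h : phi σ [0, 1, 0] = [0, 1, 0]) :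
      ∃ p : List ℕ, ∀ k : ℕ, ¬ SortedSocks ((phi σ)^[k] p) :=
    ⟨[0, 1, 0], fun k => by
      rw [Function.iterate_fixed h]; exact not_sortedSocks_zero_one_zero⟩
  rcases hlen.eq_or_lt with h₂ | h₃
  · obtain ⟨s, t, rfl⟩ := List.length_eq_two.mp h₂.symm
    by_cases hst : s = t
    · subst hst
      exact exists_never_sorted_pair_self s
    · exact fixed (phi_eq_self_of_ne hst)
  · exact fixed (phi_eq_self_of_three_le σ h₃ hσ)
end

section
/- Let σ be a sock sequence that is not sorted and is not equivalent to any pattern of the form a^i b a^j with i, j ≥ 1 (i.e. σ is not a sequence in which all socks are equal except for a single different sock occurring once, strictly between occurrences of the repeated sock). Let M be a finite multiset of socks such that at least one arrangement of M (a sock sequence whose multiset of entries is M) is not sorted. Then there exists an arrangement p* of M such that for every k ≥ 0, the iterate φ_σ^k(p*) is not sorted. -/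
attribute [local instance] Classical.propDecidable

theorem SameShape.trans {A B C : Type*} {q : List A} {r : List B} {s : List C}
    (h : SameShape q r) (h' : SameShape r s) : SameShape q s :=
  ⟨h.1.trans h'.1, fun i j => (h.2 i j).trans (h'.2 i j)⟩

theorem SameShape.sortedSocks {A B : Type*} {q : List A} {r : List B} (h : SameShape q r)
    (hq : SortedSocks q) : SortedSocks r := fun i j k hij hjk hik =>
  (h.2 j i).1 (hq i j k hij hjk ((h.2 i k).2 hik))

theorem SameShape.head?_eq_getLast?_iff {A B : Type*} {q : List A} {r : List B}
    (h : SameShape q r) : q.head? = q.getLast? ↔ r.head? = r.getLast? := by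
  rw [List.head?_eq_getElem?, List.getLast?_eq_getElem?, List.head?_eq_getElem?,
    List.getLast?_eq_getElem?, h.1]
  exact h.2 _ _

theorem sameShape_map {A B : Type*} (f : A → B) (l : List A)
    (hf : ∀ x ∈ l, ∀ y ∈ l, f x = f y → x = y) : SameShape l (l.map f) := by
  refine ⟨by simp, fun i j => ?_⟩
  rw [List.getElem?_map, List.getElem?_map]
  refine ⟨fun h => by rw [h], fun h => ?_⟩
  rcases hi : l[i]? with _ | x <;> rcases hj : l[j]? with _ | y <;> simp only [hi, hj] at h
  · rfl
  · simp at h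
  · simp at h
  · rw [hf x (List.mem_of_getElem? hi) y (List.mem_of_getElem? hj) (by simpa using h)]

/-- A sequence `a^i b a^j` with `a ≠ b` has the shape of its numeric template. -/
theorem sameShape_replicate_cons_replicate {A : Type*} {a b : A} (hab : a ≠ b) (i j : ℕ) :
    SameShape (List.replicate i a ++ b :: List.replicate j a)
      (List.replicate i (0 : ℕ) ++ 1 :: List.replicate j (0 : ℕ)) := by
  have h := sameShape_map (fun x => if x = b then (1 : ℕ) else 0)
    (List.replicate i a ++ b :: List.replicate j a) (by
      have hm : ∀ z ∈ List.replicate i a ++ b :: List.replicate j a, z = a ∨ z = b := by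
        intro z hz
        simp only [List.mem_append, List.mem_cons, List.mem_replicate] at hz
        tauto
      intro x hx y hy
      rcases hm x hx with rfl | rfl <;> rcases hm y hy with rfl | rfl <;> simp [hab])
  simpa [hab] using h

theorem sortedSocks_of_pairwise {A : Type*} {r : A → A → Prop}
    (hr : ∀ x y, r x y → r y x → x = y) {p : List A} (hp : p.Pairwise r) : SortedSocks p := by
  intro i j k hij hjk hik
  rcases hij.eq_or_lt with rfl | hij
  · rfl
  rcases hjk.eq_or_lt with rfl | hjk
  · exact hik.symm
  by_cases hk : k < p.length
  · have h1 := List.pairwise_iff_getElem.1 hp i j (by omega) (by omega) hij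
    have h2 := List.pairwise_iff_getElem.1 hp j k (by omega) hk hjk
    have hi : i < p.length := by omega
    have hj : j < p.length := by omega
    simp only [List.getElem?_eq_getElem, hi, hj, hk, Option.some.injEq] at hik ⊢
    exact hr _ _ (hik ▸ h2) h1
  · have hi : p.length ≤ i := by simpa using hik.trans (List.getElem?_eq_none (by omega))
    rw [List.getElem?_eq_none hi, List.getElem?_eq_none (by omega)]

theorem SortedSocks.reverse {A : Type*} {p : List A} (h : SortedSocks p) :
    SortedSocks p.reverse := by
  intro i j k hij hjk hik
  by_cases hk : k < p.length
  · rw [List.getElem?_reverse (by omega), List.getElem?_reverse (by omega)] at *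
    rw [h (p.length - 1 - k) (p.length - 1 - j) (p.length - 1 - i) (by omega) (by omega) hik.symm,
      hik]
  · have hi : p.length ≤ i := by
      simpa using hik.trans (List.getElem?_eq_none (by simpa using hk))
    rw [List.getElem?_eq_none (by simpa using hi.trans hij),
      List.getElem?_eq_none (by simpa using hi)]

theorem sortAux_eq_of_not_containsPat {A B : Type*} (σ : List B) (input stack : List A)
    (h : ¬ ContainsPat (input.reverse ++ stack) σ) :
    sortAux σ input stack = input.reverse ++ stack := by
  induction input generalizing stack with
  | nil => simp [sortAux]
  | cons x input ih =>
    have hx : ¬ ContainsPat (x :: stack) σ := by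
      rintro ⟨q, hq, hs⟩
      refine h ⟨q, hq.trans ?_, hs⟩
      simp
    rw [sortAux.eq_def]
    dsimp only
    rw [if_neg hx, ih _ (by simpa using h)]
    simp

theorem phi_eq_reverse {A B : Type*} (σ : List B) (p : List A)
    (h : ¬ ContainsPat p.reverse σ) : phi σ p = p.reverse := by
  simpa [phi] using sortAux_eq_of_not_containsPat σ p [] (by simpa using h)

/-- An unsorted sequence avoiding `σ` together with its reversal is never sorted by `φ_σ`. -/
theorem not_sortedSocks_iterate_phi {A B : Type*} (σ : List B) (p : List A)
    (hp : ¬ SortedSocks p) (h : ¬ ContainsPat p σ) (h' : ¬ ContainsPat p.reverse σ) (k : ℕ) :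
    ¬ SortedSocks ((phi σ)^[k] p) := by
  have hk : (phi σ)^[k] p = p ∨ (phi σ)^[k] p = p.reverse := by
    induction k with
    | zero => exact Or.inl rfl
    | succ k ih =>
      rw [Function.iterate_succ_apply']
      rcases ih with ih | ih <;> rw [ih]
      · exact Or.inr (phi_eq_reverse σ p h')
      · refine Or.inl ?_
        rw [phi_eq_reverse σ p.reverse (by simpa using h), List.reverse_reverse]
  rcases hk with hk | hk <;> rw [hk]
  · exact hp
  · exact fun hs => hp (by simpa using hs.reverse)

theorem head?_eq_getLast?_of_sublist_cons_append_replicate {A : Type*} [LinearOrder A]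
    {a : A} {R q : List A} {n : ℕ} (haR : a ∉ R) (hR : R.Pairwise (· ≤ ·))
    (hq : q.Sublist (a :: (R ++ List.replicate n a))) (hs : ¬ SortedSocks q) :
    q.head? = q.getLast? := by
  rcases List.sublist_cons_iff.1 hq with h | ⟨q', rfl, h⟩
  · refine absurd (sortedSocks_of_pairwise (r := fun x y => y = a ∨ (x ≠ a ∧ x ≤ y)) ?_
      (List.Pairwise.sublist h ?_)) hs
    · rintro x y (rfl | ⟨h1, h2⟩) (rfl | ⟨h3, h4⟩)
      · rfl
      · exact absurd rfl h3
      · exact absurd rfl h1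
      · exact le_antisymm h2 h4
    · refine List.pairwise_append.2 ⟨?_, ?_, ?_⟩
      · exact hR.imp_of_mem fun hx _ hxy => Or.inr ⟨fun e => haR (e ▸ hx), hxy⟩
      · exact List.pairwise_replicate.2 (Or.inr (Or.inl rfl))
      · exact fun x _ y hy => Or.inl (List.eq_of_mem_replicate hy)
  · obtain ⟨r, t, rfl, hr, ht⟩ := List.sublist_append_iff.1 h
    obtain ⟨t, -, rfl⟩ := List.sublist_replicate_iff.1 ht
    rcases t with _ | t
    · refine absurd (sortedSocks_of_pairwise (r := fun x y => x = a ∨ (y ≠ a ∧ x ≤ y)) ?_ ?_) hs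
      · rintro x y (rfl | ⟨h1, h2⟩) (rfl | ⟨h3, h4⟩)
        · rfl
        · exact absurd rfl h3
        · exact absurd rfl h1
        · exact le_antisymm h2 h4
      · rw [List.replicate_zero, List.append_nil, List.pairwise_cons]
        exact ⟨fun _ _ => Or.inl rfl, (hR.sublist hr).imp_of_mem
          fun _ hy hxy => Or.inr ⟨fun e => haR (e ▸ hr.subset hy), hxy⟩⟩
    · rw [List.replicate_succ', ← List.append_assoc, ← List.cons_append, List.getLast?_concat]
      rfl

theorem exists_eq_replicate_of_sublist_replicate_append {A : Type*} [LinearOrder A]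
    {a b : A} {R q : List A} {n : ℕ} (haR : a ∉ b :: R) (hR : (b :: R).Pairwise (· ≤ ·))
    (hq : q.Sublist (List.replicate n a ++ b :: a :: R)) (hs : ¬ SortedSocks q)
    (hl : q.head? = q.getLast?) :
    ∃ (c d : A) (i j : ℕ), c ≠ d ∧ 1 ≤ i ∧ 1 ≤ j ∧
      q = List.replicate i c ++ d :: List.replicate j c := by
  have hab : a ≠ b := fun e => haR (by simp [e])
  have haR' : a ∉ R := fun h => haR (by simp [h])
  have hsort : ∀ m : ℕ, ∀ l, List.Sublist l (List.replicate m a ++ R) → SortedSocks l := by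
    intro m l h
    refine sortedSocks_of_pairwise (r := fun x y => x = a ∨ (y ≠ a ∧ x ≤ y)) ?_
      (List.Pairwise.sublist h ?_)
    · rintro x y (rfl | ⟨h1, h2⟩) (rfl | ⟨h3, h4⟩)
      · rfl
      · exact absurd rfl h3
      · exact absurd rfl h1
      · exact le_antisymm h2 h4
    · refine List.pairwise_append.2 ⟨?_, ?_, ?_⟩
      · exact List.pairwise_replicate.2 (Or.inr (Or.inl rfl))
      · exact hR.of_cons.imp_of_mem fun _ hy hxy => Or.inr ⟨fun e => haR' (e ▸ hy), hxy⟩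
      · exact fun x hx y _ => Or.inl (List.eq_of_mem_replicate hx)
  obtain ⟨t, q2, rfl, ht, hq2⟩ := List.sublist_append_iff.1 hq
  obtain ⟨t, -, rfl⟩ := List.sublist_replicate_iff.1 ht
  rcases List.sublist_cons_iff.1 hq2 with h | ⟨q3, rfl, h⟩
  · refine absurd (hsort (t + 1) _ ?_) hs
    rw [List.replicate_succ', List.append_assoc]
    exact (List.Sublist.refl _).append h
  · rcases List.sublist_cons_iff.1 h with h | ⟨q4, rfl, h4⟩
    · rcases t with _ | t
      · refine absurd (sortedSocks_of_pairwise (r := fun x y : A => x ≤ y)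
          (fun _ _ => le_antisymm) (hR.sublist ?_)) hs
        simpa using h
      · have hm : a ∈ b :: q3 := by
          refine List.mem_of_getLast? ?_
          simpa [List.replicate_succ, List.getLast?_append, List.getLast?_cons] using hl.symm
        exact absurd (List.Sublist.subset (h.cons_cons b) hm) haR
    · rcases t with _ | t
      · rcases List.eq_nil_or_concat q4 with rfl | ⟨l, z, rfl⟩
        · simp at hl
          exact absurd hl.symm hab
        · have hz : z = b := by
            rw [List.concat_eq_append, ← List.cons_append, ← List.cons_append,
              ← List.append_assoc, List.getLast?_concat] at hl
            simpa using hl.symm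
          subst hz
          refine ⟨z, a, 1, (l.concat z).length, hab.symm, le_rfl, by simp, ?_⟩
          have hc : l.concat z = List.replicate (l.concat z).length z := by
            refine List.eq_replicate_of_mem fun x hx => ?_
            rw [List.concat_eq_append] at h4 hx
            refine le_antisymm ?_ ((List.pairwise_cons.1 hR).1 x (h4.subset hx))
            have hp := List.pairwise_append.1 (hR.of_cons.sublist h4)
            rcases List.mem_append.1 hx with hx | hx
            · exact hp.2.2 x hx z (by simp)
            · exact (List.mem_singleton.1 hx).le
          rw [← hc]
          simp
      · rcases List.eq_nil_or_concat q4 with rfl | ⟨l, z, rfl⟩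
        · exact ⟨a, b, t + 1, 1, hab, by omega, le_rfl, by simp⟩
        · have hz : z = a := by
            rw [List.concat_eq_append, ← List.cons_append, ← List.cons_append,
              ← List.append_assoc, List.getLast?_concat] at hl
            simpa [List.replicate_succ] using hl.symm
          exact absurd (h4.subset (show a ∈ l.concat z by simp [hz])) haR'

/-- To avoid `σ` in both reading directions it suffices that no subsequence shares the
reversal-invariant features of `σ`. -/
theorem not_containsPat_and_reverse {A B : Type*} (σ : List B) (p : List A) (Q : List A → Prop)
    (hσ : ∀ q, SameShape q σ → Q q) (hrev : ∀ q, Q q → Q q.reverse)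
    (hp : ∀ q, q.Sublist p → ¬ Q q) :
    ¬ ContainsPat p σ ∧ ¬ ContainsPat p.reverse σ := by
  constructor
  · rintro ⟨q, hq, h⟩
    exact hp q hq (hσ q h)
  · rintro ⟨q, hq, h⟩
    exact hp q.reverse (by simpa using hq.reverse) (hrev q (hσ q h))

theorem not_sortedSocks_of_getElem? {A : Type*} {p : List A} {a b : A} {i j k : ℕ} (hab : a ≠ b)
    (hij : i ≤ j) (hjk : j ≤ k) (hi : p[i]? = some a) (hj : p[j]? = some b)
    (hk : p[k]? = some a) : ¬ SortedSocks p := fun h => by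
  have := h i j k hij hjk (hi.trans hk.symm)
  rw [hi, hj, Option.some.injEq] at this
  exact hab this.symm

/-- A multiset with an unsorted arrangement has a repeated sock and another, different sock. -/
theorem exists_eq_replicate_add_sort {A : Type*} [LinearOrder A] {p : List A}
    (hp : ¬ SortedSocks p) :
    ∃ (a b : A) (n : ℕ) (R : List A), a ∉ b :: R ∧ (b :: R).Pairwise (· ≤ ·) ∧
      (p : Multiset A) = Multiset.replicate (n + 2) a + ((b :: R : List A) : Multiset A) := by
  unfold SortedSocks at hp
  push Not at hp
  obtain ⟨i, j, k, hij, hjk, hik, hne⟩ := hp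
  have hi : i < p.length := by
    by_contra hi
    exact hne (by rw [List.getElem?_eq_none (by omega), List.getElem?_eq_none (by omega)])
  have hk : k < p.length := by
    by_contra hk
    rw [List.getElem?_eq_none (i := k) (by omega)] at hik
    simp at hik
    omega
  have hj : j < p.length := by omega
  have hlt : i < k := by
    refine lt_of_le_of_ne (hij.trans hjk) ?_
    rintro rfl
    exact hne (by rw [le_antisymm hij hjk])
  simp only [List.getElem?_eq_getElem, hi, hj, hk, Option.some.injEq] at hik hne
  have hc : 2 ≤ p.count p[i] := List.duplicate_iff_two_le_count.1
    (List.duplicate_iff_exists_distinct_get.2 ⟨⟨i, hi⟩, ⟨k, hk⟩, hlt, rfl, hik⟩)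
  set a := p[i] with ha
  obtain ⟨n, hn⟩ := Nat.exists_eq_add_of_le' hc
  have hmem : ∀ x, x ∈ ((p : Multiset A).filter (fun x => ¬ x = a)).sort (· ≤ ·) ↔
      x ∈ p ∧ x ≠ a := by simp
  rcases hR : ((p : Multiset A).filter (fun x => ¬ x = a)).sort (· ≤ ·) with _ | ⟨b, R⟩
  · have := (hmem p[j]).2 ⟨List.getElem_mem hj, fun e => hne (by rw [e])⟩
    rw [hR] at this
    simp at this
  · refine ⟨a, b, n, R, ?_, ?_, ?_⟩
    · rw [← hR, hmem]
      simp
    · rw [← hR]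
      exact Multiset.pairwise_sort _ _
    · rw [← hR, Multiset.sort_eq, ← hn, ← Multiset.coe_count, ← Multiset.filter_eq',
        Multiset.filter_add_not]

/-- Proposition: let `σ` be an unsorted sock pattern that is not of the form
`a^i b a^j` with `i, j ≥ 1`.  Then for any finite multiset of socks `M` such
that some arrangement of `M` is not sorted, there is an arrangement `p*` of
`M` such that no iterate `φ_σ^k(p*)` is ever sorted. -/
theorem exists_never_sorted_arrangement {A B : Type*} (σ : List B)
    (hσ : ¬ SortedSocks σ)
    (hform : ¬ ∃ i j : ℕ, 1 ≤ i ∧ 1 ≤ j ∧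
      SameShape σ (List.replicate i (0 : ℕ) ++ 1 :: List.replicate j (0 : ℕ)))
    (M : Multiset A) (hM : ∃ p : List A, (p : Multiset A) = M ∧ ¬ SortedSocks p) :
    ∃ p : List A, (p : Multiset A) = M ∧
      ∀ k : ℕ, ¬ SortedSocks ((phi σ)^[k] p) := by
  let : LinearOrder A := linearOrderOfSTO WellOrderingRel
  obtain ⟨p, rfl, hp⟩ := hM
  obtain ⟨a, b, n, R, haR, hR, hM⟩ := exists_eq_replicate_add_sort hp
  have hab : a ≠ b := fun e => haR (by simp [e])
  by_cases hl : σ.head? = σ.getLast?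
  · have hu : ¬ SortedSocks (List.replicate (n + 1) a ++ b :: a :: R) :=
      not_sortedSocks_of_getElem? (i := n) (j := n + 1) (k := n + 2) hab (by omega) (by omega)
        (by simp [List.getElem?_append]) (by simp) (by simp [List.getElem?_append])
    obtain ⟨h1, h2⟩ := not_containsPat_and_reverse σ (List.replicate (n + 1) a ++ b :: a :: R)
      (fun q => ¬ SortedSocks q ∧ q.head? = q.getLast? ∧
        ¬ ∃ (c d : A) (i j : ℕ), c ≠ d ∧ 1 ≤ i ∧ 1 ≤ j ∧
          q = List.replicate i c ++ d :: List.replicate j c)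
      (fun q hq => ⟨fun hs => hσ (hq.sortedSocks hs), hq.head?_eq_getLast?_iff.2 hl, by
        rintro ⟨c, d, i, j, hcd, hi, hj, rfl⟩
        exact hform ⟨i, j, hi, hj, hq.symm.trans (sameShape_replicate_cons_replicate hcd i j)⟩⟩)
      (fun q ⟨h1, h2, h3⟩ => ⟨fun hs => h1 (by simpa using hs.reverse), by simpa using h2.symm, by
        rintro ⟨c, d, i, j, hcd, hi, hj, hq⟩
        refine h3 ⟨c, d, j, i, hcd, hj, hi, ?_⟩
        rw [← List.reverse_reverse q, hq]
        simp⟩)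
      (fun q hq ⟨hs, hl, hf⟩ =>
        hf (exists_eq_replicate_of_sublist_replicate_append haR hR hq hs hl))
    refine ⟨_, ?_, not_sortedSocks_iterate_phi σ _ hu h1 h2⟩
    rw [hM, ← Multiset.coe_replicate, Multiset.coe_add, Multiset.coe_eq_coe,
      List.replicate_succ' (n := n + 1), List.append_assoc]
    exact (List.Perm.swap _ _ _).append_left _
  · have hu : ¬ SortedSocks (a :: (b :: R ++ List.replicate (n + 1) a)) :=
      not_sortedSocks_of_getElem? (i := 0) (j := 1) (k := R.length + 2) hab (by omega) (by omega)
        (by simp) (by simp) (by simp)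
    obtain ⟨h1, h2⟩ := not_containsPat_and_reverse σ (a :: (b :: R ++ List.replicate (n + 1) a))
      (fun q => ¬ SortedSocks q ∧ ¬ q.head? = q.getLast?)
      (fun q hq => ⟨fun hs => hσ (hq.sortedSocks hs), fun h => hl (hq.head?_eq_getLast?_iff.1 h)⟩)
      (fun q ⟨h1, h2⟩ => ⟨fun hs => h1 (by simpa using hs.reverse),
        fun h => h2 (by simpa using h.symm)⟩)
      (fun q hq ⟨hs, hl⟩ =>
        hl (head?_eq_getLast?_of_sublist_cons_append_replicate haR hR hq hs))
    refine ⟨_, ?_, not_sortedSocks_iterate_phi σ _ hu h1 h2⟩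
    rw [hM, ← Multiset.coe_replicate, Multiset.coe_add, Multiset.coe_eq_coe,
      List.replicate_succ (n := n + 1)]
    exact List.perm_append_comm.cons a
end
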